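/- Let α be a multiplicative character of κ with α ≠ ε. Then for every λ ∈ κ*: (1/(1−q)) · ∑_ν [(α)_ν / (ε)°_ν] · ν(λ) = ᾱ(1−λ), where the sum runs over all multiplicative characters ν of κ. (That is, the finite-field analogue of ₁F₀(α;λ) equals ᾱ(1−λ).) -/

import Mathlib

/-!
Finite-field hypergeometric functions (Otsubo), basic definitions:
`κ` is a finite field with `q = Fintype.card κ` elements, `ψ` a fixed nontrivial
additive character, multiplicative characters are `MulChar κ ℂ` (extended by `0`
on `0`, with trivial character `1`).
-/

open scoped Classical

noncomputable section

variable {κ : Type*} [Field κ] [Fintype κ]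

instance : Fintype (MulChar κ ℂ) := Fintype.ofFinite _

/-- The Gauss sum `g(φ) = -∑_{x ∈ κ} ψ(x) φ(x)`. -/
def gS (ψ : AddChar κ ℂ) (φ : MulChar κ ℂ) : ℂ := -∑ x : κ, ψ x * φ x

/-- The variant `g°(φ) = q^{δ(φ)} · g(φ)`, where `δ(φ) = 1` iff `φ` is trivial. -/
def gSo (ψ : AddChar κ ℂ) (φ : MulChar κ ℂ) : ℂ :=
  (if φ = 1 then (Fintype.card κ : ℂ) else 1) * gS ψ φ

/-- The Pochhammer symbol `(α)_ν = g(αν)/g(α)`. -/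
def poch (ψ : AddChar κ ℂ) (α ν : MulChar κ ℂ) : ℂ := gS ψ (α * ν) / gS ψ α

/-- The variant Pochhammer symbol `(α)°_ν = g°(αν)/g°(α)`. -/
def pocho (ψ : AddChar κ ℂ) (α ν : MulChar κ ℂ) : ℂ := gSo ψ (α * ν) / gSo ψ α

theorem gS_eq_neg_gaussSum (ψ : AddChar κ ℂ) (φ : MulChar κ ℂ) : gS ψ φ = -gaussSum φ ψ := by
  simp only [gS, gaussSum, mul_comm]

theorem gS_ne_zero {ψ : AddChar κ ℂ} (hψ : ψ ≠ 1) {φ : MulChar κ ℂ} (hφ : φ ≠ 1) :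
    gS ψ φ ≠ 0 := by
  rw [gS_eq_neg_gaussSum]
  exact neg_ne_zero.mpr (gaussSum_ne_zero_of_nontrivial
    (Nat.cast_ne_zero.mpr Fintype.card_ne_zero) hφ (AddChar.IsPrimitive.of_ne_one hψ))

/-- The reflection formula `g°(ν) g(ν⁻¹) = ν(-1) q`. -/
theorem gSo_mul_gS_inv {ψ : AddChar κ ℂ} (hψ : ψ ≠ 1) (ν : MulChar κ ℂ) :
    gSo ψ ν * gS ψ ν⁻¹ = ν (-1) * Fintype.card κ := by
  by_cases hν : ν = 1
  · subst hν
    have h : (1 : MulChar κ ℂ) (-1) = 1 := MulChar.one_apply isUnit_one.neg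
    simp [gSo, gS_eq_neg_gaussSum, gaussSum_one_left hψ, h]
  · have hinv : ν⁻¹ (-1) = ν (-1) := by rw [MulChar.inv_apply', inv_neg_one]
    rw [gSo, if_neg hν, one_mul, gS_eq_neg_gaussSum, gS_eq_neg_gaussSum, neg_mul_neg,
      ← mul_gaussSum_inv_eq_gaussSum ν⁻¹, hinv, mul_left_comm,
      gaussSum_mul_gaussSum_eq_card hν (AddChar.IsPrimitive.of_ne_one hψ)]

theorem poch_div_pocho_one {ψ : AddChar κ ℂ} (hψ : ψ ≠ 1) (α ν : MulChar κ ℂ) :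
    poch ψ α ν / pocho ψ 1 ν = (gS ψ α)⁻¹ * (gS ψ (α * ν) * gS ψ ν⁻¹ * ν (-1)) := by
  have hq : (Fintype.card κ : ℂ) ≠ 0 := Nat.cast_ne_zero.mpr Fintype.card_ne_zero
  have hone : gSo ψ (1 : MulChar κ ℂ) = Fintype.card κ := by
    simp [gSo, gS_eq_neg_gaussSum, gaussSum_one_left hψ]
  have hsq : ν (-1) * ν (-1) = 1 := by rw [← map_mul, neg_mul_neg, one_mul, map_one]
  have hrefl := gSo_mul_gS_inv hψ ν
  have hν : gSo ψ ν ≠ 0 := by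
    intro h
    rw [h, zero_mul] at hrefl
    exact mul_ne_zero (left_ne_zero_of_mul_eq_one hsq) hq hrefl.symm
  have hdiv : Fintype.card κ / gSo ψ ν = gS ψ ν⁻¹ * ν (-1) := by
    rw [div_eq_iff hν]
    linear_combination (-(Fintype.card κ : ℂ)) * hsq - ν (-1) * hrefl
  rw [poch, pocho, one_mul, hone, div_div_eq_mul_div, mul_div_assoc, hdiv]
  ring

theorem sum_mulChar_apply (a : κ) :
    ∑ ν : MulChar κ ℂ, ν a = if a = 1 then (Fintype.card κ : ℂ) - 1 else 0 := by
  split_ifs with ha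
  · have h : Fintype.card (MulChar κ ℂ) = Fintype.card κ - 1 := by
      rw [← Nat.card_eq_fintype_card, MulChar.card_eq_card_units_of_hasEnoughRootsOfUnity,
        Nat.card_eq_fintype_card, Fintype.card_units]
    simp [ha, h, Nat.cast_sub Fintype.card_pos]
  · obtain ⟨χ, hχ⟩ := MulChar.exists_apply_ne_one_of_hasEnoughRootsOfUnity κ ℂ ha
    refine eq_zero_of_mul_eq_self_left hχ ?_
    simp only [Finset.mul_sum, ← MulChar.mul_apply]
    exact Fintype.sum_bijective _ (Group.mulLeft_bijective χ) _ _ fun _ ↦ rfl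

theorem sum_gaussSum_mul_gaussSum_inv (ψ : AddChar κ ℂ) (α : MulChar κ ℂ) {a : κ} (ha : a ≠ 0) :
    ∑ ν : MulChar κ ℂ, gaussSum (α * ν) ψ * gaussSum ν⁻¹ ψ * ν a =
      (Fintype.card κ - 1) * gaussSum α (ψ.mulShift (1 + a)) := by
  have expand (ν : MulChar κ ℂ) : gaussSum (α * ν) ψ * gaussSum ν⁻¹ ψ * ν a =
      ∑ x, ∑ y, α x * ψ x * ψ y * ν (x * y⁻¹ * a) := by
    simp only [gaussSum, Finset.sum_mul, Finset.mul_sum, MulChar.mul_apply,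
      MulChar.inv_apply', map_mul]
    rw [Finset.sum_comm]
    exact Finset.sum_congr rfl fun x _ ↦ Finset.sum_congr rfl fun y _ ↦ by ring
  simp only [expand]
  rw [Finset.sum_comm, gaussSum, Finset.mul_sum]
  refine Finset.sum_congr rfl fun x _ ↦ ?_
  rw [Finset.sum_comm]
  simp only [← Finset.mul_sum, sum_mulChar_apply]
  rcases eq_or_ne x 0 with rfl | hx
  · simp [MulChar.map_zero]
  have hiff (y : κ) : x * y⁻¹ * a = 1 ↔ y = a * x := by
    rcases eq_or_ne y 0 with rfl | hy
    · simp [ha, hx]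
    · field_simp
      rw [eq_comm, mul_comm]
  simp only [hiff, mul_ite, mul_zero, Finset.sum_ite_eq', Finset.mem_univ, if_true,
    AddChar.mulShift_apply, add_mul, one_mul, AddChar.map_add_eq_mul]
  ring

theorem gaussSum_mulShift_of_ne_one (ψ : AddChar κ ℂ) {α : MulChar κ ℂ} (hα : α ≠ 1) (a : κ) :
    gaussSum α (ψ.mulShift a) = α⁻¹ a * gaussSum α ψ := by
  rcases eq_or_ne a 0 with rfl | ha
  · rw [AddChar.mulShift_zero, gaussSum_one_right hα, MulChar.map_zero, zero_mul]
  · exact gaussSum_mulShift_eq α ψ (Units.mk0 a ha)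

/-- for `α ≠ ε` and `λ ≠ 0`,
`(1/(1-q)) ∑_ν ((α)_ν/(ε)°_ν) ν(λ) = ᾱ(1-λ)`. -/
theorem stmt_5 (ψ : AddChar κ ℂ) (hψ : ψ ≠ 1) (α : MulChar κ ℂ) (hα : α ≠ 1)
    (l : κ) (hl : l ≠ 0) :
    (1 - (Fintype.card κ : ℂ))⁻¹ *
        ∑ ν : MulChar κ ℂ, (poch ψ α ν / pocho ψ 1 ν) * ν l =
      α⁻¹ (1 - l) := by
  have hg := gS_ne_zero hψ hα
  have hq : 1 - (Fintype.card κ : ℂ) ≠ 0 :=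
    sub_ne_zero.mpr (mod_cast (Fintype.one_lt_card (α := κ)).ne)
  have hterm (ν : MulChar κ ℂ) : poch ψ α ν / pocho ψ 1 ν * ν l =
      (gS ψ α)⁻¹ * (gaussSum (α * ν) ψ * gaussSum ν⁻¹ ψ * ν (-l)) := by
    rw [poch_div_pocho_one hψ, gS_eq_neg_gaussSum ψ (α * ν), gS_eq_neg_gaussSum ψ ν⁻¹,
      ← neg_one_mul l, map_mul]
    ring
  simp only [hterm]
  rw [← Finset.mul_sum, sum_gaussSum_mul_gaussSum_inv ψ α (neg_ne_zero.mpr hl),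
    ← sub_eq_add_neg, gaussSum_mulShift_of_ne_one ψ hα, ← neg_neg (gaussSum α ψ),
    ← gS_eq_neg_gaussSum]
  field_simp
  ring

end
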